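/- arXiv:1702.01423 — 10 statements merged into one kernel-verified Lean document; each statement's English description precedes it below -/
import Mathlib

section
/- Let k ≥ 0 be an integer and ℓ = 3^k. The polynomial p0(X) = X^{2ℓ} + X^ℓ + 1 over the binary field 𝔽₂ is irreducible. -/
open Polynomial

/-- If `3 ^ (k + 1)` divides `2 ^ d - 1`, then `2 * 3 ^ k` divides `d`. -/
lemma two_mul_three_pow_dvd_of_dvd_two_pow_sub_one {k d : ℕ} (hd : d ≠ 0)
    (h : 3 ^ (k + 1) ∣ 2 ^ d - 1) : 2 * 3 ^ k ∣ d := by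
  have h3 : 3 ∣ 2 ^ d - 1 := (dvd_pow_self 3 k.succ_ne_zero).trans h
  obtain ⟨m, rfl | rfl⟩ := d.even_or_odd'
  · have hm : m ≠ 0 := by rintro rfl; exact hd rfl
    refine mul_dvd_mul_left 2 ?_
    rw [pow_mul] at h
    have hlt : 1 < (2 ^ 2) ^ m := Nat.one_lt_pow hm (by norm_num)
    have hval := padicValNat.pow_sub_pow (p := 3) (x := 2 ^ 2) (y := 1) (by decide)
      (by norm_num) (by norm_num) (by norm_num) hm
    rw [one_pow, show 2 ^ 2 - 1 = 3 from rfl, padicValNat_self] at hval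
    rw [padicValNat_dvd_iff_le (by omega)] at h
    rw [padicValNat_dvd_iff_le hm]
    omega
  · have h4 : 4 ^ m % 3 = 1 := by simp [Nat.pow_mod]
    rw [pow_succ, pow_mul] at h3
    norm_num at h3
    omega

lemma orderOf_unitOfCoprime_two_three_pow (k : ℕ) (h : Nat.Coprime 2 (3 ^ (k + 1))) :
    orderOf (ZMod.unitOfCoprime 2 h) = 2 * 3 ^ k := by
  refine Nat.dvd_antisymm ?_ ?_
  · have hcard := orderOf_dvd_card (x := ZMod.unitOfCoprime 2 h)
    rwa [ZMod.card_units_eq_totient, Nat.totient_prime_pow_succ Nat.prime_three,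
      mul_comm] at hcard
  · refine two_mul_three_pow_dvd_of_dvd_two_pow_sub_one (orderOf_pos _).ne' ?_
    have hpow := congrArg Units.val (pow_orderOf_eq_one (ZMod.unitOfCoprime 2 h))
    rw [Units.val_pow_eq_pow_val, ZMod.coe_unitOfCoprime, Units.val_one] at hpow
    rw [← ZMod.natCast_eq_zero_iff, Nat.cast_sub Nat.one_le_two_pow, Nat.cast_pow, hpow,
      Nat.cast_one, sub_self]

/-- For `ℓ = 3^k`, the polynomial `X^(2ℓ) + X^ℓ + 1` over `𝔽₂` is irreducible. -/
theorem stmt_1 (k : ℕ) :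
    Irreducible ((X : Polynomial (ZMod 2)) ^ (2 * 3 ^ k) + X ^ (3 ^ k) + 1) := by
  have hcyc : (X : Polynomial (ZMod 2)) ^ (2 * 3 ^ k) + X ^ (3 ^ k) + 1 =
      cyclotomic (3 ^ (k + 1)) (ZMod 2) := by
    rw [cyclotomic_prime_pow_eq_geom_sum Nat.prime_three]
    simp only [Finset.sum_range_succ, Finset.sum_range_zero]
    ring
  have hndvd : ¬ 2 ∣ 3 ^ (k + 1) := fun h => by
    have := Nat.prime_two.dvd_of_dvd_pow h
    omega
  rw [hcyc]
  refine ZMod.irreducible_of_dvd_cyclotomic_of_natDegree hndvd dvd_rfl ?_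
  rw [orderOf_unitOfCoprime_two_three_pow, natDegree_cyclotomic,
    Nat.totient_prime_pow_succ Nat.prime_three, mul_comm]
end

section
/- Let k ≥ 0 be an integer and ℓ = 3^k. Let s : ℤ → 𝔽₂ satisfy the linear recurrence s(t+2ℓ) = s(t+ℓ) + s(t) for all t ∈ ℤ. Then s(t+3ℓ) = s(t) for all t ∈ ℤ; and if s is not identically zero, then the least period of s is exactly 3ℓ, i.e. min{ τ > 0 : ∀t, s(t+τ) = s(t) } = 3ℓ. -/
/-- The gcd of two periods of a function on `ℤ` is a period. -/
theorem Function.Periodic.nat_gcd {α : Type*} {f : ℤ → α} {a b : ℕ}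
    (ha : Function.Periodic f (a : ℤ)) (hb : Function.Periodic f (b : ℤ)) :
    Function.Periodic f (Nat.gcd a b : ℤ) := by
  rw [Nat.gcd_eq_gcd_ab, mul_comm (a : ℤ), mul_comm (b : ℤ)]
  exact (ha.int_mul _).add_period (hb.int_mul _)

/-- A function on `ℤ` with period `p ^ (k + 1)`, `p` prime, and a smaller positive period
has period `p ^ k`. -/
theorem Function.Periodic.prime_pow_of_lt {α : Type*} {f : ℤ → α} {p k τ : ℕ} (hp : p.Prime)
    (h : Function.Periodic f ((p ^ (k + 1) : ℕ) : ℤ)) (hτ : Function.Periodic f (τ : ℤ))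
    (hpos : 0 < τ) (hlt : τ < p ^ (k + 1)) : Function.Periodic f ((p ^ k : ℕ) : ℤ) := by
  have hgcd := hτ.nat_gcd h
  obtain ⟨j, hj, hj'⟩ := (Nat.dvd_prime_pow hp).1 (Nat.gcd_dvd_right τ (p ^ (k + 1)))
  have hle : p ^ j ≤ τ := hj' ▸ Nat.gcd_le_left _ hpos
  have hjk : j ≤ k :=
    Nat.lt_succ_iff.1 ((Nat.pow_lt_pow_iff_right hp.one_lt).1 (hle.trans_lt hlt))
  obtain ⟨c, hc⟩ := pow_dvd_pow p hjk
  rw [hj'] at hgcd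
  rw [hc, mul_comm, Nat.cast_mul]
  exact hgcd.nat_mul c

/-- For `ℓ = 3^k`, if `s : ℤ → 𝔽₂` satisfies `s(t+2ℓ) = s(t+ℓ) + s(t)` for all `t`,
then `s(t+3ℓ) = s(t)` for all `t`; and if `s` is not identically zero, its least
period is exactly `3ℓ`. -/
theorem stmt_4 (k : ℕ) (s : ℤ → ZMod 2)
    (hrec : ∀ t : ℤ, s (t + 2 * 3 ^ k) = s (t + 3 ^ k) + s t) :
    (∀ t : ℤ, s (t + 3 * 3 ^ k) = s t) ∧
      (s ≠ 0 → sInf {τ : ℕ | 0 < τ ∧ ∀ t : ℤ, s (t + τ) = s t} = 3 * 3 ^ k) := by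
  have hper : ∀ t : ℤ, s (t + 3 * 3 ^ k) = s t := by
    intro t
    have h := hrec (t + 3 ^ k)
    rw [show t + 3 ^ k + 2 * 3 ^ k = t + 3 * 3 ^ k by ring,
      show t + 3 ^ k + 3 ^ k = t + 2 * 3 ^ k by ring, hrec t] at h
    rw [h, add_right_comm, CharTwo.add_self_eq_zero, zero_add]
  refine ⟨hper, fun hs => ?_⟩
  refine IsLeast.csInf_eq ⟨⟨by positivity, fun t => by exact_mod_cast hper t⟩, ?_⟩
  rintro τ ⟨hpos, hτ⟩
  by_contra! hlt
  have hℓ : Function.Periodic s ((3 ^ k : ℕ) : ℤ) :=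
    Function.Periodic.prime_pow_of_lt Nat.prime_three
      (fun t => by rw [pow_succ']; exact_mod_cast hper t) hτ hpos (by rwa [pow_succ'])
  push_cast at hℓ
  refine hs (funext fun t => ?_)
  have h := hrec t
  rw [two_mul, ← add_assoc, hℓ, hℓ, CharTwo.add_self_eq_zero] at h
  exact h
end

section
/- Let k ≥ 0 be an integer and ℓ = 3^k. Let s : ℤ → 𝔽₂ satisfy the linear recurrence s(t+2ℓ+1) = s(t+2ℓ) + s(t+ℓ+1) + s(t+ℓ) + s(t+1) + s(t) for all t ∈ ℤ. Then s(t+3ℓ) = s(t) for all t ∈ ℤ; the constant sequences 0 and 1 both satisfy the recurrence; and if s is not constant then its least period is exactly 3ℓ. -/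
/-- The least positive period of a periodic sequence divides every period. -/
lemma sInf_periods_dvd {α : Type*} {s : ℤ → α} {n : ℕ}
    (hτ : 0 < sInf {τ : ℕ | 0 < τ ∧ ∀ t : ℤ, s (t + τ) = s t})
    (hn : Function.Periodic s (n : ℤ)) :
    sInf {τ : ℕ | 0 < τ ∧ ∀ t : ℤ, s (t + τ) = s t} ∣ n := by
  have hmem := Nat.sInf_mem (Nat.nonempty_of_pos_sInf hτ)
  set τ := sInf {τ : ℕ | 0 < τ ∧ ∀ t : ℤ, s (t + τ) = s t}
  have hper : Function.Periodic s (τ : ℤ) := hmem.2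
  have hmod : Function.Periodic s ((n % τ : ℕ) : ℤ) := by
    have h := hn.sub_period (hper.nat_mul (n / τ))
    have e : ((n % τ : ℕ) : ℤ) = (n : ℤ) - ((n / τ : ℕ) : ℤ) * (τ : ℤ) := by
      rw [eq_sub_iff_add_eq]
      exact_mod_cast Nat.mod_add_div' n τ
    rwa [e]
  by_contra hdvd
  have hpos : 0 < n % τ := Nat.pos_of_ne_zero fun h => hdvd (Nat.dvd_of_mod_eq_zero h)
  exact (Nat.mod_lt n hτ).not_ge (Nat.sInf_le ⟨hpos, hmod⟩)

/-- If `(X + 1)(X^{2ℓ} + X^ℓ + 1)` annihilates `s`, then `X^{2ℓ} + X^ℓ + 1` maps `s` to a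
constant sequence. -/
lemma exists_const_of_recurrence {s : ℤ → ZMod 2} {l : ℤ}
    (hrec : ∀ t : ℤ, s (t + 2 * l + 1) =
      s (t + 2 * l) + s (t + l + 1) + s (t + l) + s (t + 1) + s t) :
    ∃ c, ∀ t : ℤ, s (t + 2 * l) + s (t + l) + s t = c := by
  have h : Function.Periodic (fun t => s (t + 2 * l) + s (t + l) + s t) 1 := by
    intro t
    have e₁ : t + 1 + 2 * l = t + 2 * l + 1 := by ring
    have e₂ : t + 1 + l = t + l + 1 := by ring
    simp only [e₁, e₂, hrec t]
    generalize s (t + 2 * l) = a, s (t + l + 1) = b, s (t + l) = c, s (t + 1) = d, s t = e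
    revert a b c d e
    decide
  exact ⟨_, fun t => by simpa using h.int_mul_eq t⟩

/-- For `ℓ = 3^k`, if `s : ℤ → 𝔽₂` satisfies
`s(t+2ℓ+1) = s(t+2ℓ) + s(t+ℓ+1) + s(t+ℓ) + s(t+1) + s(t)` for all `t`, then
`s(t+3ℓ) = s(t)` for all `t`; the constant sequences `0` and `1` both satisfy the
recurrence; and if `s` is not constant then its least period is exactly `3ℓ`. -/
theorem stmt_5 (k : ℕ) (s : ℤ → ZMod 2)
    (hrec : ∀ t : ℤ, s (t + 2 * 3 ^ k + 1) =
      s (t + 2 * 3 ^ k) + s (t + 3 ^ k + 1) + s (t + 3 ^ k) + s (t + 1) + s t) :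
    (∀ t : ℤ, s (t + 3 * 3 ^ k) = s t) ∧
      (∀ c : ZMod 2, ∀ t : ℤ,
        (fun _ : ℤ => c) (t + 2 * 3 ^ k + 1) =
          (fun _ : ℤ => c) (t + 2 * 3 ^ k) + (fun _ : ℤ => c) (t + 3 ^ k + 1) +
            (fun _ : ℤ => c) (t + 3 ^ k) + (fun _ : ℤ => c) (t + 1) + (fun _ : ℤ => c) t) ∧
      ((¬ ∃ c : ZMod 2, ∀ t : ℤ, s t = c) →
        sInf {τ : ℕ | 0 < τ ∧ ∀ t : ℤ, s (t + τ) = s t} = 3 * 3 ^ k) := by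
  obtain ⟨c, hc⟩ := exists_const_of_recurrence hrec
  have hper : ∀ t : ℤ, s (t + 3 * 3 ^ k) = s t := by
    intro t
    have h := (hc (t + 3 ^ k)).trans (hc t).symm
    have e₁ : t + 3 ^ k + 2 * 3 ^ k = t + 3 * 3 ^ k := by ring
    have e₂ : t + 3 ^ k + 3 ^ k = t + 2 * 3 ^ k := by ring
    rw [e₁, e₂] at h
    linear_combination h
  refine ⟨hper, fun c _ => by
    beta_reduce
    revert c
    decide, fun hs => ?_⟩
  have hmem := Nat.sInf_mem (s := {τ : ℕ | 0 < τ ∧ ∀ t : ℤ, s (t + τ) = s t})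
    ⟨3 * 3 ^ k, by positivity, by exact_mod_cast hper⟩
  have hdvd := sInf_periods_dvd (s := s) (n := 3 ^ (k + 1)) hmem.1 fun t => by
    push_cast
    rw [pow_succ']
    exact hper t
  obtain ⟨j, hj, hτ⟩ := (Nat.dvd_prime_pow Nat.prime_three).1 hdvd
  obtain rfl | hjk : j = k + 1 ∨ j ≤ k := by omega
  · rw [hτ, pow_succ']
  refine absurd ⟨c, fun t => ?_⟩ hs
  have hl : Function.Periodic s (3 ^ k : ℤ) := by
    have hp : Function.Periodic s (3 ^ j : ℤ) := by
      rw [hτ] at hmem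
      exact_mod_cast hmem.2
    have h := hp.nat_mul (3 ^ (k - j))
    push_cast at h
    rwa [← pow_add, Nat.sub_add_cancel hjk] at h
  have h2 : s (t + 2 * 3 ^ k) = s t := by
    rw [two_mul, ← add_assoc, hl, hl]
  have h := hc t
  rw [h2, hl t, CharTwo.add_self_eq_zero, zero_add] at h
  exact h
end

section
/- Let k ≥ 0 be an integer and ℓ = 3^k. Let L : 𝔽₂^{4ℓ} → 𝔽₂^{4ℓ} be the linear map L(x_0, x_1, …, x_{4ℓ−1}) = (x_1, …, x_{4ℓ−1}, x_{2ℓ} + x_0). Then the set { v ∈ 𝔽₂^{4ℓ} : L^{3ℓ}(v) = v } of fixed points of L^{3ℓ} has exactly 2^{2ℓ} elements. -/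
/-- The output sequence of the LFSR with recurrence `s (n + 4ℓ) = s (n + 2ℓ) + s n` and
initial state `v`. -/
def lfsrSeq {ℓ : ℕ} (hℓ : 0 < ℓ) (v : Fin (4 * ℓ) → ZMod 2) (m : ℕ) : ZMod 2 :=
  if h : m < 4 * ℓ then v ⟨m, h⟩
  else lfsrSeq hℓ v (m - 2 * ℓ) + lfsrSeq hℓ v (m - 4 * ℓ)
termination_by m

theorem lfsrSeq_of_lt {ℓ : ℕ} (hℓ : 0 < ℓ) (v : Fin (4 * ℓ) → ZMod 2) {m : ℕ}
    (h : m < 4 * ℓ) : lfsrSeq hℓ v m = v ⟨m, h⟩ := by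
  rw [lfsrSeq, dif_pos h]

theorem lfsrSeq_add {ℓ : ℕ} (hℓ : 0 < ℓ) (v : Fin (4 * ℓ) → ZMod 2) (n : ℕ) :
    lfsrSeq hℓ v (n + 4 * ℓ) = lfsrSeq hℓ v (n + 2 * ℓ) + lfsrSeq hℓ v n := by
  rw [lfsrSeq, dif_neg (by omega)]
  congr 2 <;> omega

theorem lfsrSeq_periodic {ℓ : ℕ} (hℓ : 0 < ℓ) (v : Fin (4 * ℓ) → ZMod 2) (n : ℕ) :
    lfsrSeq hℓ v (n + 6 * ℓ) = lfsrSeq hℓ v n := by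
  have h₁ := lfsrSeq_add hℓ v (n + 2 * ℓ)
  have h₂ := lfsrSeq_add hℓ v n
  rw [show n + 2 * ℓ + 4 * ℓ = n + 6 * ℓ by ring, show n + 2 * ℓ + 2 * ℓ = n + 4 * ℓ by ring,
    h₂, add_right_comm, CharTwo.add_self_eq_zero, zero_add] at h₁
  exact h₁

/-- Iterating the state transformation shifts the output sequence. -/
theorem lfsr_iterate_apply {ℓ : ℕ} (hℓ : 0 < ℓ)
    (L : (Fin (4 * ℓ) → ZMod 2) → (Fin (4 * ℓ) → ZMod 2))
    (hL : ∀ (x : Fin (4 * ℓ) → ZMod 2) (i : Fin (4 * ℓ)),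
      L x i = if h : (i : ℕ) + 1 < 4 * ℓ then x ⟨(i : ℕ) + 1, h⟩
        else x ⟨2 * ℓ, by omega⟩ + x ⟨0, by omega⟩)
    (v : Fin (4 * ℓ) → ZMod 2) (n : ℕ) (i : Fin (4 * ℓ)) :
    L^[n] v i = lfsrSeq hℓ v (i + n) := by
  induction n generalizing i with
  | zero => simp [lfsrSeq_of_lt hℓ v i.isLt]
  | succ n ih =>
    rw [Function.iterate_succ_apply', hL]
    split_ifs with h
    · rw [ih, add_right_comm, add_assoc]
    · rw [ih, ih, show (i : ℕ) + (n + 1) = n + 4 * ℓ by omega, lfsrSeq_add]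
      simp [add_comm]

/-- The fixed points of the `3ℓ`-th iterate are the states `(a, b, a + b, a)` in blocks of
length `ℓ`. -/
theorem lfsr_iterate_fixed_iff {ℓ : ℕ} (hℓ : 0 < ℓ)
    (L : (Fin (4 * ℓ) → ZMod 2) → (Fin (4 * ℓ) → ZMod 2))
    (hL : ∀ (x : Fin (4 * ℓ) → ZMod 2) (i : Fin (4 * ℓ)),
      L x i = if h : (i : ℕ) + 1 < 4 * ℓ then x ⟨(i : ℕ) + 1, h⟩
        else x ⟨2 * ℓ, by omega⟩ + x ⟨0, by omega⟩)
    (v : Fin (4 * ℓ) → ZMod 2) :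
    L^[3 * ℓ] v = v ↔ ∀ j (hj : j < ℓ),
      v ⟨j + 2 * ℓ, by omega⟩ = v ⟨j + ℓ, by omega⟩ + v ⟨j, by omega⟩ ∧
      v ⟨j + 3 * ℓ, by omega⟩ = v ⟨j, by omega⟩ := by
  have hshift := lfsr_iterate_apply hℓ L hL v (3 * ℓ)
  have hsum {j : ℕ} (hj : j < 2 * ℓ) : lfsrSeq hℓ v (j + 4 * ℓ) =
      v ⟨j + 2 * ℓ, by omega⟩ + v ⟨j, by omega⟩ := by
    rw [lfsrSeq_add, lfsrSeq_of_lt, lfsrSeq_of_lt]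
  constructor
  · intro hv j hj
    rw [hv] at hshift
    constructor
    · have h := hshift ⟨j + ℓ, by omega⟩
      simp only [show j + ℓ + 3 * ℓ = j + 4 * ℓ by ring, hsum (by omega : j < 2 * ℓ)] at h
      rw [h, add_assoc, CharTwo.add_self_eq_zero, add_zero]
    · have h := hshift ⟨j, by omega⟩
      rw [lfsrSeq_of_lt hℓ v (by simp only; omega)] at h
      exact h.symm
  · intro hv
    ext ⟨i, hi⟩
    rw [hshift]
    simp only
    by_cases h₁ : i < ℓ
    · rw [lfsrSeq_of_lt hℓ v (by omega), (hv i h₁).2]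
    by_cases h₂ : i < 2 * ℓ
    · obtain ⟨j, rfl⟩ := Nat.exists_eq_add_of_le' (not_lt.mp h₁)
      rw [show j + ℓ + 3 * ℓ = j + 4 * ℓ by ring, hsum (by omega), (hv j (by omega)).1,
        add_assoc, CharTwo.add_self_eq_zero, add_zero]
    by_cases h₃ : i < 3 * ℓ
    · obtain ⟨j, rfl⟩ := Nat.exists_eq_add_of_le' (not_lt.mp h₂)
      have h := hsum (by omega : j + ℓ < 2 * ℓ)
      simp only [show j + ℓ + 2 * ℓ = j + 3 * ℓ by ring] at h
      rw [show j + 2 * ℓ + 3 * ℓ = j + ℓ + 4 * ℓ by ring, h, (hv j (by omega)).1,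
        (hv j (by omega)).2, add_comm]
    · obtain ⟨j, rfl⟩ := Nat.exists_eq_add_of_le' (not_lt.mp h₃)
      rw [show j + 3 * ℓ + 3 * ℓ = j + 6 * ℓ by ring, lfsrSeq_periodic,
        lfsrSeq_of_lt hℓ v (by omega), (hv j (by omega)).2]

/-- There are `2 ^ (2ℓ)` binary states of the form `(a, b, a + b, a)` in blocks of length `ℓ`. -/
theorem ncard_block_states (ℓ : ℕ) :
    {v : Fin (4 * ℓ) → ZMod 2 | ∀ j (hj : j < ℓ),
      v ⟨j + 2 * ℓ, by omega⟩ = v ⟨j + ℓ, by omega⟩ + v ⟨j, by omega⟩ ∧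
      v ⟨j + 3 * ℓ, by omega⟩ = v ⟨j, by omega⟩}.ncard = 2 ^ (2 * ℓ) := by
  have hcard : (Set.univ : Set (Fin (2 * ℓ) → ZMod 2)).ncard = 2 ^ (2 * ℓ) := by
    simp [Set.ncard_univ]
  rw [← hcard]
  refine Set.ncard_congr (fun v _ i => v ⟨i, by omega⟩) (fun _ _ => Set.mem_univ _) ?_ ?_
  · intro v w hv hw hvw
    have hlow {i : ℕ} (hi : i < 2 * ℓ) : v ⟨i, by omega⟩ = w ⟨i, by omega⟩ :=
      congrFun hvw ⟨i, hi⟩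
    ext ⟨i, hi⟩
    by_cases h₂ : i < 2 * ℓ
    · exact hlow h₂
    by_cases h₃ : i < 3 * ℓ
    · obtain ⟨j, rfl⟩ := Nat.exists_eq_add_of_le' (not_lt.mp h₂)
      rw [(hv j (by omega)).1, (hw j (by omega)).1, hlow (by omega), hlow (by omega)]
    · obtain ⟨j, rfl⟩ := Nat.exists_eq_add_of_le' (not_lt.mp h₃)
      rw [(hv j (by omega)).2, (hw j (by omega)).2, hlow (by omega)]
  · intro w _
    refine ⟨fun i => if h₂ : (i : ℕ) < 2 * ℓ then w ⟨i, h₂⟩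
      else if h₃ : (i : ℕ) < 3 * ℓ then
        w ⟨i - 2 * ℓ + ℓ, by omega⟩ + w ⟨i - 2 * ℓ, by omega⟩
      else w ⟨i - 3 * ℓ, by omega⟩, ?_, ?_⟩
    · intro j hj
      simp [show j < 2 * ℓ by omega, show j + ℓ < 2 * ℓ by omega,
        show j + 2 * ℓ < 3 * ℓ by omega, show ¬ j + 3 * ℓ < 2 * ℓ by omega]
    · ext i
      simp

/-- For `ℓ = 3^k`, the state transformation `L` of the `4ℓ`-stage LFSR with
characteristic polynomial `X^(4ℓ) + X^(2ℓ) + 1`, i.e.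
`L(x_0,…,x_{4ℓ−1}) = (x_1,…,x_{4ℓ−1}, x_{2ℓ} + x_0)`, has exactly `2^(2ℓ)` fixed
points of `L^(3ℓ)`. -/
theorem stmt_7 (k : ℕ)
    (L : (Fin (4 * 3 ^ k) → ZMod 2) → (Fin (4 * 3 ^ k) → ZMod 2))
    (hL : ∀ (x : Fin (4 * 3 ^ k) → ZMod 2) (i : Fin (4 * 3 ^ k)),
      L x i =
        if h : (i : ℕ) + 1 < 4 * 3 ^ k then x ⟨(i : ℕ) + 1, h⟩
        else
          x ⟨2 * 3 ^ k, by have := pow_pos (by norm_num : (0:ℕ) < 3) k; omega⟩ +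
            x ⟨0, by have := pow_pos (by norm_num : (0:ℕ) < 3) k; omega⟩) :
    {v : Fin (4 * 3 ^ k) → ZMod 2 | L^[3 * 3 ^ k] v = v}.ncard = 2 ^ (2 * 3 ^ k) := by
  have hℓ : 0 < 3 ^ k := by positivity
  rw [← ncard_block_states (3 ^ k)]
  congr 1
  ext v
  exact lfsr_iterate_fixed_iff hℓ L hL v
end

section
/- Let m ≥ 1, let g : 𝔽₂^{m−1} → 𝔽₂, and let F : 𝔽₂^m → 𝔽₂^m be defined by F(x_0, x_1, …, x_{m−1}) = (x_1, …, x_{m−1}, x_0 + g(x_1, …, x_{m−1})) (so F is a bijection). Identify each vector (x_0,…,x_{m−1}) ∈ 𝔽₂^m with the integer Σ_{j=0}^{m−1} x_j 2^j, and for u ∈ 𝔽₂^m let û = u + (1,0,…,0) denote its conjugate. For v ∈ 𝔽₂^m let O(v) = { F^i(v) : i ≥ 0 } denote its F-orbit. Then for every u ∈ 𝔽₂^m, either min(O(u) ∪ O(û)) < min{u, û} (as integers), or u ∈ {(0,0,…,0), (1,0,…,0)}. -/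
/-- The integer value `Σ_{j<m} x_j 2^j` of a state `x ∈ 𝔽₂^m`. -/
def stateVal (m : ℕ) (x : Fin m → ZMod 2) : ℕ :=
  ∑ j : Fin m, (x j).val * 2 ^ (j : ℕ)

/-- The conjugate `û` of a state `u ∈ 𝔽₂^m`: flip the first coordinate. -/
def conjState (m : ℕ) (u : Fin m → ZMod 2) : Fin m → ZMod 2 :=
  fun i => if (i : ℕ) = 0 then u i + 1 else u i

/-- The state transformation of a nonsingular `m`-stage FSR with feedback
`f1(x_0,…,x_{m−1}) = x_0 + g(x_1,…,x_{m−1})`. -/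
def fsrTrans (m : ℕ) (g : (Fin (m - 1) → ZMod 2) → ZMod 2)
    (x : Fin m → ZMod 2) : Fin m → ZMod 2 :=
  fun i =>
    if h : (i : ℕ) + 1 < m then x ⟨(i : ℕ) + 1, h⟩
    else x ⟨0, i.pos⟩ + g (fun j => x ⟨(j : ℕ) + 1, by have := j.isLt; omega⟩)

/-- The `F`-orbit `{ F^i(v) : i ≥ 0 }` of a point `v`. -/
def orbitOf {α : Type*} (F : α → α) (v : α) : Set α :=
  Set.range fun i : ℕ => F^[i] v

/-- The integer value of the tail `(x_1, …, x_n)` of a state `x ∈ 𝔽₂^(n+1)`. -/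
def tailVal (n : ℕ) (x : Fin (n + 1) → ZMod 2) : ℕ :=
  ∑ j : Fin n, (x j.succ).val * 2 ^ (j : ℕ)

theorem stateVal_eq_add_two_mul_tailVal (n : ℕ) (x : Fin (n + 1) → ZMod 2) :
    stateVal (n + 1) x = (x 0).val + 2 * tailVal n x := by
  simp only [stateVal, tailVal, Fin.sum_univ_succ, Finset.mul_sum, Fin.val_zero, pow_zero, mul_one,
    Fin.val_succ]
  congr 1
  exact Finset.sum_congr rfl fun j _ => by ring

theorem tailVal_conjState (n : ℕ) (x : Fin (n + 1) → ZMod 2) :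
    tailVal n (conjState (n + 1) x) = tailVal n x := by
  simp [tailVal, conjState]

theorem stateVal_fsrTrans (n : ℕ) (g : (Fin n → ZMod 2) → ZMod 2) (x : Fin (n + 1) → ZMod 2) :
    stateVal (n + 1) (fsrTrans (n + 1) g x)
      = tailVal n x + (x 0 + g fun j => x j.succ).val * 2 ^ n := by
  simp only [stateVal, tailVal, Fin.sum_univ_castSucc]
  congr 1
  · refine Finset.sum_congr rfl fun j _ => ?_
    simp [fsrTrans, Fin.succ]
  · simp [fsrTrans, Fin.succ]

theorem tailVal_eq_zero_iff (n : ℕ) (x : Fin (n + 1) → ZMod 2) :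
    tailVal n x = 0 ↔ ∀ j : Fin n, x j.succ = 0 := by
  simp [tailVal, Finset.sum_eq_zero_iff]

/-- One of the successors of `x` and its conjugate has last coordinate `0`. -/
theorem exists_stateVal_fsrTrans_eq_tailVal (n : ℕ) (g : (Fin n → ZMod 2) → ZMod 2)
    (x : Fin (n + 1) → ZMod 2) :
    stateVal (n + 1) (fsrTrans (n + 1) g x) = tailVal n x ∨
      stateVal (n + 1) (fsrTrans (n + 1) g (conjState (n + 1) x)) = tailVal n x := by
  have key : ∀ a b : ZMod 2, a + b = 0 ∨ a + 1 + b = 0 := by decide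
  rw [stateVal_fsrTrans, stateVal_fsrTrans, tailVal_conjState]
  refine (key (x 0) (g fun j => x j.succ)).imp (fun h => ?_) fun h => ?_
  · simp [h]
  · simp [conjState, h]

/-- For every `u ∈ 𝔽₂^m`, either
`min(O(u) ∪ O(û)) < min{u, û}` (as integers) or `u ∈ {(0,…,0), (1,0,…,0)}`. -/
theorem stmt_9 (m : ℕ) (hm : 1 ≤ m) (g : (Fin (m - 1) → ZMod 2) → ZMod 2)
    (u : Fin m → ZMod 2) :
    sInf (stateVal m ''
        (orbitOf (fsrTrans m g) u ∪ orbitOf (fsrTrans m g) (conjState m u)))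
          < min (stateVal m u) (stateVal m (conjState m u)) ∨
      u = (fun _ => (0 : ZMod 2)) ∨ u = (fun i : Fin m => if (i : ℕ) = 0 then (1 : ZMod 2) else 0) := by
  obtain ⟨n, rfl⟩ : ∃ n, m = n + 1 := ⟨m - 1, by omega⟩
  rcases Nat.eq_zero_or_pos (tailVal n u) with h0 | hpos
  · right
    rw [tailVal_eq_zero_iff] at h0
    have key : ∀ a : ZMod 2, a = 0 ∨ a = 1 := by decide
    refine (key (u 0)).imp (fun h => ?_) fun h => ?_ <;>
    · funext i
      refine Fin.cases ?_ (fun j => ?_) i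
      · simpa using h
      · simpa using h0 j
  · left
    have hle : sInf (stateVal (n + 1) '' (orbitOf (fsrTrans (n + 1) g) u ∪
        orbitOf (fsrTrans (n + 1) g) (conjState (n + 1) u))) ≤ tailVal n u := by
      rcases exists_stateVal_fsrTrans_eq_tailVal n g u with h | h
      · exact Nat.sInf_le ⟨_, Or.inl ⟨1, rfl⟩, h⟩
      · exact Nat.sInf_le ⟨_, Or.inr ⟨1, rfl⟩, h⟩
    refine hle.trans_lt ?_
    rw [stateVal_eq_add_two_mul_tailVal, stateVal_eq_add_two_mul_tailVal, tailVal_conjState]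
    omega
end

section
/- Let m ≥ 1 and let S be a finite nonempty set of periodic sequences s : ℤ → 𝔽₂ that is closed under the shift operator (if s ∈ S then the sequence t ↦ s(t+1) is in S). For k ≥ 1 let W_k(S) = { (s(t), s(t+1), …, s(t+k−1)) : s ∈ S, t ∈ ℤ } ⊆ 𝔽₂^k. Then the following three statements are equivalent: (i) |W_m(S)| = |S|; (ii) the map (a_1, …, a_{m+1}) ↦ (a_2, …, a_{m+1}) (dropping the first coordinate) is injective on W_{m+1}(S); (iii) the map (a_1, …, a_{m+1}) ↦ (a_1, …, a_m) (dropping the last coordinate) is injective on W_{m+1}(S). -/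
/-- The set `W_k(S)` of all length-`k` windows occurring in sequences of `S`. -/
def windows (k : ℕ) (S : Set (ℤ → ZMod 2)) : Set (Fin k → ZMod 2) :=
  {w | ∃ s ∈ S, ∃ t : ℤ, w = fun i : Fin k => s (t + (i : ℕ))}

theorem shift_nat_mem {S : Set (ℤ → ZMod 2)}
    (hshift : ∀ s ∈ S, (fun t => s (t + 1)) ∈ S) {s : ℤ → ZMod 2} (hs : s ∈ S) (n : ℕ) :
    (fun t => s (t + n)) ∈ S := by
  induction n with
  | zero => simpa using hs
  | succ n ih =>
    convert hshift _ ih using 2 with t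
    push_cast
    ring_nf

theorem periodic_add_nat_mul {s : ℤ → ZMod 2} {τ : ℕ} (h : ∀ t : ℤ, s (t + τ) = s t)
    (n : ℕ) (t : ℤ) : s (t + n * τ) = s t :=
  (Function.Periodic.nat_mul (f := s) (c := (τ : ℤ)) h n) t

theorem shift_int_mem {S : Set (ℤ → ZMod 2)}
    (hper : ∀ s ∈ S, ∃ τ : ℕ, 0 < τ ∧ ∀ t : ℤ, s (t + τ) = s t)
    (hshift : ∀ s ∈ S, (fun t => s (t + 1)) ∈ S) {s : ℤ → ZMod 2} (hs : s ∈ S) (z : ℤ) :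
    (fun t => s (t + z)) ∈ S := by
  obtain ⟨τ, hτ, h⟩ := hper s hs
  have hz : 0 ≤ z + z.natAbs * (τ : ℤ) := by
    have h1 : -z ≤ (z.natAbs : ℤ) := by omega
    have h2 : (1 : ℤ) ≤ τ := by exact_mod_cast hτ
    nlinarith [Int.natCast_nonneg z.natAbs]
  obtain ⟨n, hn⟩ := Int.eq_ofNat_of_zero_le hz
  convert shift_nat_mem hshift hs n using 2 with t
  rw [← hn, ← add_assoc, periodic_add_nat_mul h]

theorem eq_of_eq_on_nat {s s' : ℤ → ZMod 2} {τ τ' : ℕ} (hτ : 0 < τ) (hτ' : 0 < τ')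
    (h : ∀ t : ℤ, s (t + τ) = s t) (h' : ∀ t : ℤ, s' (t + τ') = s' t)
    (heq : ∀ n : ℕ, s n = s' n) : s = s' := by
  funext t
  have ht : 0 ≤ t + t.natAbs * ((τ : ℤ) * τ') := by
    have h1 : -t ≤ (t.natAbs : ℤ) := by omega
    have h2 : (1 : ℤ) ≤ (τ : ℤ) * τ' := by exact_mod_cast Nat.mul_pos hτ hτ'
    nlinarith [Int.natCast_nonneg t.natAbs]
  obtain ⟨n, hn⟩ := Int.eq_ofNat_of_zero_le ht
  have e : s (t + t.natAbs * ((τ : ℤ) * τ')) = s t := by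
    rw [← periodic_add_nat_mul h (t.natAbs * τ') t]
    push_cast
    ring_nf
  have e' : s' (t + t.natAbs * ((τ : ℤ) * τ')) = s' t := by
    rw [← periodic_add_nat_mul h' (t.natAbs * τ) t]
    push_cast
    ring_nf
  rw [← e, ← e', hn]
  exact heq n

/-- The window of length `k` of the sequence `s` starting at time `0`. -/
def initialWindow (k : ℕ) (s : ℤ → ZMod 2) : Fin k → ZMod 2 := fun i => s (i : ℕ)

theorem windows_eq_image {S : Set (ℤ → ZMod 2)}
    (hper : ∀ s ∈ S, ∃ τ : ℕ, 0 < τ ∧ ∀ t : ℤ, s (t + τ) = s t)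
    (hshift : ∀ s ∈ S, (fun t => s (t + 1)) ∈ S) (k : ℕ) :
    windows k S = initialWindow k '' S := by
  ext w
  constructor
  · rintro ⟨s, hs, t, rfl⟩
    refine ⟨_, shift_int_mem hper hshift hs t, ?_⟩
    funext i
    simp [initialWindow, add_comm]
  · rintro ⟨s, hs, rfl⟩
    exact ⟨s, hs, 0, by funext i; simp [initialWindow]⟩

theorem image_castSucc_windows (m : ℕ) (S : Set (ℤ → ZMod 2)) :
    (fun (a : Fin (m + 1) → ZMod 2) (i : Fin m) => a i.castSucc) '' windows (m + 1) S =
      windows m S := by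
  ext w
  constructor
  · rintro ⟨_, ⟨s, hs, t, rfl⟩, rfl⟩
    exact ⟨s, hs, t, rfl⟩
  · rintro ⟨s, hs, t, rfl⟩
    exact ⟨_, ⟨s, hs, t, rfl⟩, rfl⟩

theorem image_succ_windows (m : ℕ) (S : Set (ℤ → ZMod 2)) :
    (fun (a : Fin (m + 1) → ZMod 2) (i : Fin m) => a i.succ) '' windows (m + 1) S =
      windows m S := by
  ext w
  constructor
  · rintro ⟨_, ⟨s, hs, t, rfl⟩, rfl⟩
    refine ⟨s, hs, t + 1, ?_⟩
    funext i
    simp [add_comm, add_left_comm]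
  · rintro ⟨s, hs, t, rfl⟩
    refine ⟨_, ⟨s, hs, t - 1, rfl⟩, ?_⟩
    funext i
    simp

theorem injOn_initialWindow_iff {m : ℕ} (hm : 1 ≤ m) {S : Set (ℤ → ZMod 2)}
    (hper : ∀ s ∈ S, ∃ τ : ℕ, 0 < τ ∧ ∀ t : ℤ, s (t + τ) = s t)
    (hshift : ∀ s ∈ S, (fun t => s (t + 1)) ∈ S) :
    Set.InjOn (initialWindow m) S ↔
      Set.InjOn (fun (a : Fin (m + 1) → ZMod 2) (i : Fin m) => a i.castSucc)
        (windows (m + 1) S) := by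
  rw [windows_eq_image hper hshift]
  constructor
  · rintro h _ ⟨s, hs, rfl⟩ _ ⟨s', hs', rfl⟩ heq
    rw [h hs hs' heq]
  · intro h s hs s' hs' heq
    have key : ∀ n : ℕ, initialWindow m (fun t => s (t + n)) =
        initialWindow m (fun t => s' (t + n)) := by
      intro n
      induction n with
      | zero => simpa using heq
      | succ n ih =>
        have e := h ⟨_, shift_nat_mem hshift hs n, rfl⟩ ⟨_, shift_nat_mem hshift hs' n, rfl⟩ ih
        funext i
        simpa [initialWindow, add_comm, add_left_comm] using congrFun e i.succ
    obtain ⟨τ, hτ, hp⟩ := hper s hs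
    obtain ⟨τ', hτ', hp'⟩ := hper s' hs'
    refine eq_of_eq_on_nat hτ hτ' hp hp' fun n => ?_
    simpa [initialWindow] using congrFun (key n) ⟨0, hm⟩

/-- For `S` a finite nonempty shift-closed set of periodic sequences, the following
are equivalent: (i) `|W_m(S)| = |S|`; (ii) dropping the first coordinate is injective
on `W_{m+1}(S)`; (iii) dropping the last coordinate is injective on `W_{m+1}(S)`. -/
theorem stmt_11 (m : ℕ) (hm : 1 ≤ m) (S : Set (ℤ → ZMod 2))
    (hfin : S.Finite) (hne : S.Nonempty)
    (hper : ∀ s ∈ S, ∃ τ : ℕ, 0 < τ ∧ ∀ t : ℤ, s (t + τ) = s t)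
    (hshift : ∀ s ∈ S, (fun t => s (t + 1)) ∈ S) :
    ((windows m S).ncard = S.ncard ↔
      Set.InjOn (fun (a : Fin (m + 1) → ZMod 2) (i : Fin m) => a i.succ)
        (windows (m + 1) S)) ∧
    (Set.InjOn (fun (a : Fin (m + 1) → ZMod 2) (i : Fin m) => a i.succ)
        (windows (m + 1) S) ↔
      Set.InjOn (fun (a : Fin (m + 1) → ZMod 2) (i : Fin m) => a i.castSucc)
        (windows (m + 1) S)) := by
  have hcard : ∀ f : (Fin (m + 1) → ZMod 2) → (Fin m → ZMod 2),
      f '' windows (m + 1) S = windows m S →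
      ((windows m S).ncard = (windows (m + 1) S).ncard ↔ Set.InjOn f (windows (m + 1) S)) := by
    intro f hf
    rw [← hf]
    exact Set.ncard_image_iff (Set.toFinite _)
  have hdrop := (hcard _ (image_succ_windows m S)).symm.trans
    (hcard _ (image_castSucc_windows m S))
  refine ⟨?_, hdrop⟩
  rw [hdrop, ← injOn_initialWindow_iff hm hper hshift, windows_eq_image hper hshift]
  exact Set.ncard_image_iff hfin
end

section
/- Let X be a finite set, F' : X → X a bijection, and let a, b ∈ X be distinct elements lying in different F'-orbits. Define F : X → X by F(a) = F'(b), F(b) = F'(a), and F(x) = F'(x) for all x ∉ {a, b}. Then F is a bijection, and the F-orbit of a equals the union of the F'-orbit of a and the F'-orbit of b; in particular, if the F'-orbits of a and b have sizes p and q respectively, then the F-orbit of a has size p + q. -/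
theorem self_mem_orbitOf {α : Type*} (F : α → α) (v : α) : v ∈ orbitOf F v :=
  ⟨0, rfl⟩

theorem apply_mem_orbitOf {α : Type*} {F : α → α} {v x : α} (hx : x ∈ orbitOf F v) :
    F x ∈ orbitOf F v := by
  obtain ⟨i, rfl⟩ := hx
  exact ⟨i + 1, Function.iterate_succ_apply' F i v⟩

/-- The orbit of `v` is the least forward-invariant set containing `v`. -/
theorem orbitOf_subset {α : Type*} {F : α → α} {v : α} {S : Set α} (hv : v ∈ S)
    (hS : ∀ x ∈ S, F x ∈ S) : orbitOf F v ⊆ S := by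
  rintro _ ⟨i, rfl⟩
  induction i with
  | zero => exact hv
  | succ i ih =>
    simp only [Function.iterate_succ_apply']
    exact hS _ ih

theorem orbitOf_subset_orbitOf {α : Type*} {F : α → α} {v x : α} (hx : x ∈ orbitOf F v) :
    orbitOf F x ⊆ orbitOf F v :=
  orbitOf_subset hx fun _ => apply_mem_orbitOf

theorem mem_orbitOf_apply {α : Type*} [Finite α] {F : α → α} (hF : Function.Injective F)
    (v : α) : v ∈ orbitOf F (F v) := by
  obtain ⟨n, hn, hper⟩ := hF.mem_periodicPts v
  obtain ⟨m, rfl⟩ := Nat.exists_eq_succ_of_ne_zero hn.ne'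
  exact ⟨m, hper⟩

theorem mem_orbitOf_symm {α : Type*} [Finite α] {F : α → α} (hF : Function.Injective F)
    {v x : α} (hx : x ∈ orbitOf F v) : v ∈ orbitOf F x :=
  orbitOf_subset (S := {y | v ∈ orbitOf F y}) (self_mem_orbitOf F v)
    (fun y hy => orbitOf_subset_orbitOf (mem_orbitOf_apply hF y) hy) hx

theorem disjoint_orbitOf {α : Type*} [Finite α] {F : α → α} (hF : Function.Injective F)
    {v w : α} (h : w ∉ orbitOf F v) : Disjoint (orbitOf F v) (orbitOf F w) :=
  Set.disjoint_left.2 fun _ hv hw =>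
    h (orbitOf_subset_orbitOf hv (mem_orbitOf_symm hF hw))

/-- Cycle joining: if `F'` is a bijection of a finite set, `a ≠ b` lie in different
`F'`-orbits, and `F` is obtained from `F'` by swapping the images of `a` and `b`,
then `F` is a bijection, the `F`-orbit of `a` is the union of the `F'`-orbits of `a`
and `b`, and its size is the sum of their sizes. -/
theorem stmt_13 {X : Type*} [Finite X] (F' : X → X) (hF' : Function.Bijective F')
    (a b : X) (hab : a ≠ b) (horb : b ∉ orbitOf F' a)
    (F : X → X) (hFa : F a = F' b) (hFb : F b = F' a)
    (hF : ∀ x, x ≠ a → x ≠ b → F x = F' x) :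
    Function.Bijective F ∧
      orbitOf F a = orbitOf F' a ∪ orbitOf F' b ∧
      (orbitOf F a).ncard = (orbitOf F' a).ncard + (orbitOf F' b).ncard := by
  have hinj := hF'.injective
  have hbij : Function.Bijective F := by
    classical
    have hcomp : F = F' ∘ Equiv.swap a b := by
      funext x
      by_cases hxa : x = a
      · simp [hxa, hFa]
      by_cases hxb : x = b
      · simp [hxb, hFb]
      · simp [Equiv.swap_apply_of_ne_of_ne hxa hxb, hF x hxa hxb]
    exact hcomp ▸ hF'.comp (Equiv.swap a b).bijective
  have ha : a ∉ orbitOf F' b := fun h => horb (mem_orbitOf_symm hinj h)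
  have hb : b ∈ orbitOf F a := by
    by_contra hb
    have hsub : orbitOf F' (F' b) ⊆ orbitOf F a ∩ orbitOf F' b := by
      refine orbitOf_subset
        ⟨hFa ▸ apply_mem_orbitOf (self_mem_orbitOf F a),
          apply_mem_orbitOf (self_mem_orbitOf F' b)⟩ ?_
      rintro x ⟨hx, hx'⟩
      refine ⟨?_, apply_mem_orbitOf hx'⟩
      rw [← hF x (fun h => ha (h ▸ hx')) (fun h => hb (h ▸ hx))]
      exact apply_mem_orbitOf hx
    exact hb (hsub (mem_orbitOf_apply hinj b)).1
  have hclosed : ∀ x ∈ orbitOf F a, F' x ∈ orbitOf F a := by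
    intro x hx
    by_cases hxa : x = a
    · rw [hxa, ← hFb]
      exact apply_mem_orbitOf hb
    by_cases hxb : x = b
    · rw [hxb, ← hFa]
      exact apply_mem_orbitOf (self_mem_orbitOf F a)
    · rw [← hF x hxa hxb]
      exact apply_mem_orbitOf hx
  have horbit : orbitOf F a = orbitOf F' a ∪ orbitOf F' b := by
    refine Set.Subset.antisymm (orbitOf_subset (Or.inl (self_mem_orbitOf F' a)) ?_)
      (Set.union_subset (orbitOf_subset (self_mem_orbitOf F a) hclosed)
        (orbitOf_subset hb hclosed))
    intro x hx
    by_cases hxa : x = a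
    · rw [hxa, hFa]
      exact Or.inr (apply_mem_orbitOf (self_mem_orbitOf F' b))
    by_cases hxb : x = b
    · rw [hxb, hFb]
      exact Or.inl (apply_mem_orbitOf (self_mem_orbitOf F' a))
    · rw [hF x hxa hxb]
      exact hx.imp apply_mem_orbitOf apply_mem_orbitOf
  exact ⟨hbij, horbit, horbit ▸ Set.ncard_union_eq (disjoint_orbitOf hinj horb)⟩
end

section
/- Let k ≥ 0 be an integer and ℓ = 3^k. Let L : 𝔽₂^{4ℓ} → 𝔽₂^{4ℓ} be the linear map L(x_0, x_1, …, x_{4ℓ−1}) = (x_1, …, x_{4ℓ−1}, x_{2ℓ} + x_0), and let e = (1, 0, …, 0) ∈ 𝔽₂^{4ℓ}. If v ∈ 𝔽₂^{4ℓ} satisfies L^{3ℓ}(v) = v, then min{ i > 0 : L^i(v + e) = v + e } = 6ℓ. -/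
open Function

/-- In a shift-like map, the `i`-th coordinate of an iterate is the `0`-th coordinate of a later
iterate. -/
lemma iterate_apply_eq_iterate_apply_zero {α : Type*} {N : ℕ} (hN : 0 < N)
    {L : (Fin N → α) → Fin N → α}
    (hL : ∀ (x : Fin N → α) (i : ℕ) (h : i + 1 < N), L x ⟨i, by omega⟩ = x ⟨i + 1, h⟩)
    (x : Fin N → α) (i : ℕ) (hi : i < N) (n : ℕ) :
    (L^[n] x) ⟨i, hi⟩ = (L^[n + i] x) ⟨0, hN⟩ := by
  induction i generalizing n with
  | zero => rfl
  | succ i ih =>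
    rw [← hL (L^[n] x) i hi, ← iterate_succ_apply' L, ih (by omega) (n + 1),
      add_right_comm, add_assoc]

/-- A divisor of `6 * 3 ^ k` is the whole number unless it divides one of its maximal proper
divisors. -/
lemma eq_or_dvd_of_dvd_six_mul_three_pow {k d : ℕ} (hd : d ∣ 6 * 3 ^ k) :
    d = 6 * 3 ^ k ∨ d ∣ 3 * 3 ^ k ∨ d ∣ 2 * 3 ^ k := by
  obtain ⟨c, hc⟩ := hd
  rcases eq_or_ne c 1 with rfl | hc1
  · left; omega
  right
  obtain ⟨p, hp, b, rfl⟩ := Nat.exists_prime_and_dvd hc1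
  have hdvd : p ∣ 2 * 3 ^ (k + 1) := ⟨d * b, by rw [pow_succ]; linarith⟩
  rcases hp.dvd_mul.1 hdvd with h | h
  · obtain rfl := (Nat.prime_dvd_prime_iff_eq hp Nat.prime_two).1 h
    exact Or.inl ⟨b, by linarith⟩
  · obtain rfl := (Nat.prime_dvd_prime_iff_eq hp Nat.prime_three).1 (hp.dvd_of_dvd_pow h)
    exact Or.inr ⟨b, by linarith⟩

/-- The least positive period is `Function.minimalPeriod`. -/
lemma sInf_pos_iterate_eq_eq_minimalPeriod {α : Type*} {f : α → α} {x : α}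
    (hx : 0 < minimalPeriod f x) :
    sInf {i : ℕ | 0 < i ∧ f^[i] x = x} = minimalPeriod f x :=
  le_antisymm (Nat.sInf_le ⟨hx, iterate_minimalPeriod⟩)
    (le_csInf ⟨_, hx, iterate_minimalPeriod⟩ fun _ hi => IsPeriodicPt.minimalPeriod_le hi.1 hi.2)

/-- For `ℓ = 3^k`, let `L` be the state transformation of the `4ℓ`-stage LFSR with
characteristic polynomial `X^(4ℓ) + X^(2ℓ) + 1`, and `e = (1,0,…,0)`. If
`L^(3ℓ)(v) = v` then `min{ i > 0 : L^i(v + e) = v + e } = 6ℓ`. -/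
theorem stmt_14 (k : ℕ)
    (L : (Fin (4 * 3 ^ k) → ZMod 2) → (Fin (4 * 3 ^ k) → ZMod 2))
    (hL : ∀ (x : Fin (4 * 3 ^ k) → ZMod 2) (i : Fin (4 * 3 ^ k)),
      L x i =
        if h : (i : ℕ) + 1 < 4 * 3 ^ k then x ⟨(i : ℕ) + 1, h⟩
        else
          x ⟨2 * 3 ^ k, by have := pow_pos (by norm_num : (0:ℕ) < 3) k; omega⟩ +
            x ⟨0, by have := pow_pos (by norm_num : (0:ℕ) < 3) k; omega⟩)
    (e : Fin (4 * 3 ^ k) → ZMod 2)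
    (he : e = fun i : Fin (4 * 3 ^ k) => if (i : ℕ) = 0 then (1 : ZMod 2) else 0)
    (v : Fin (4 * 3 ^ k) → ZMod 2) (hv : L^[3 * 3 ^ k] v = v) :
    sInf {i : ℕ | 0 < i ∧ L^[i] (v + e) = v + e} = 6 * 3 ^ k := by
  have hpos : 0 < 3 ^ k := by positivity
  have hN : 0 < 4 * 3 ^ k := by omega
  have hcoord := iterate_apply_eq_iterate_apply_zero hN (L := L)
    fun x i h => by rw [hL, dif_pos h]
  have hrec (x : Fin (4 * 3 ^ k) → ZMod 2) (n : ℕ) : (L^[n + 4 * 3 ^ k] x) ⟨0, hN⟩ =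
      (L^[n + 2 * 3 ^ k] x) ⟨0, hN⟩ + (L^[n] x) ⟨0, hN⟩ := by
    have h := hL (L^[n] x) ⟨4 * 3 ^ k - 1, by omega⟩
    rw [dif_neg (by simp only; omega), ← iterate_succ_apply' L, hcoord,
      hcoord x (2 * 3 ^ k)] at h
    rwa [show n.succ + (4 * 3 ^ k - 1) = n + 4 * 3 ^ k by omega] at h
  have hperiodic : IsPeriodicPt L (6 * 3 ^ k) (v + e) := by
    funext i
    have h₁ := hrec (v + e) (i + 2 * 3 ^ k)
    have h₂ := hrec (v + e) i
    rw [show (i : ℕ) + 2 * 3 ^ k + 4 * 3 ^ k = 6 * 3 ^ k + i by omega,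
      show (i : ℕ) + 2 * 3 ^ k + 2 * 3 ^ k = i + 4 * 3 ^ k by omega, h₂] at h₁
    have h₀ := hcoord (v + e) i i.2 0
    rw [zero_add] at h₀
    rw [hcoord _ i i.2, h₁, ← h₀, iterate_zero_apply, add_right_comm, CharTwo.add_self_eq_zero,
      zero_add]
  have hne : (v + e) ⟨3 * 3 ^ k, by omega⟩ ≠ (v + e) ⟨0, hN⟩ := by
    have h := hcoord v (3 * 3 ^ k) (by omega) 0
    rw [zero_add, hv, iterate_zero_apply] at h
    simp [he, h]
  have hmin : minimalPeriod L (v + e) = 6 * 3 ^ k := by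
    rcases eq_or_dvd_of_dvd_six_mul_three_pow hperiodic.minimalPeriod_dvd with h | h | h
    · exact h
    · have hw : L^[3 * 3 ^ k] (v + e) = v + e := isPeriodicPt_iff_minimalPeriod_dvd.2 h
      have h₀ := hcoord (v + e) (3 * 3 ^ k) (by omega) 0
      rw [zero_add, hw] at h₀
      exact absurd h₀ hne
    · have hw : IsPeriodicPt L (2 * 3 ^ k) (v + e) := isPeriodicPt_iff_minimalPeriod_dvd.2 h
      have hzero (i : ℕ) (hi : i < 4 * 3 ^ k) : (v + e) ⟨i, hi⟩ = 0 := by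
        have h₁ := hrec (v + e) i
        have hw' : IsPeriodicPt L (4 * 3 ^ k) (v + e) :=
          isPeriodicPt_iff_minimalPeriod_dvd.2 (h.trans ⟨2, by ring⟩)
        rw [iterate_add_apply, iterate_add_apply, hw.eq, hw'.eq,
          CharTwo.add_self_eq_zero] at h₁
        have h₀ := hcoord (v + e) i hi 0
        rwa [zero_add, h₁] at h₀
      exact absurd ((hzero _ _).trans (hzero _ _).symm) hne
  rw [sInf_pos_iterate_eq_eq_minimalPeriod (by omega), hmin]
end

section
/- For Boolean functions f : 𝔽₂^{n+1} → 𝔽₂ and g : 𝔽₂^{m+1} → 𝔽₂ define their product f⋆g : 𝔽₂^{n+m+1} → 𝔽₂ by (f⋆g)(x_0, …, x_{n+m}) = f(g(x_0,…,x_m), g(x_1,…,x_{m+1}), …, g(x_n,…,x_{n+m})), and for h : 𝔽₂^{m+1} → 𝔽₂ let Seq(h) = { s : ℤ → 𝔽₂ | ∀ t ∈ ℤ, h(s(t), s(t+1), …, s(t+m)) = 0 }. Let h : 𝔽₂^{m+1} → 𝔽₂ with h(0,…,0) = 0, and suppose h = f ⋆ g where f : 𝔽₂^{m−k+1} → 𝔽₂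 and g : 𝔽₂^{k+1} → 𝔽₂ for some 1 ≤ k < m. Then there exist h1 : 𝔽₂^{m−k+1} → 𝔽₂ and h2 : 𝔽₂^{k+1} → 𝔽₂ such that h = h1 ⋆ h2, h2(0,…,0) = 0, h1(0,…,0) = 0, and Seq(h2) ⊆ Seq(h). -/
/-- The product `f ⋆ g` of Boolean functions `f : 𝔽₂^(n+1) → 𝔽₂` and
`g : 𝔽₂^(m+1) → 𝔽₂`:
`(f ⋆ g)(x_0,…,x_{n+m}) = f(g(x_0,…,x_m), g(x_1,…,x_{m+1}), …, g(x_n,…,x_{n+m}))`. -/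
def starF (n m : ℕ) (f : (Fin (n + 1) → ZMod 2) → ZMod 2)
    (g : (Fin (m + 1) → ZMod 2) → ZMod 2) : (Fin (n + m + 1) → ZMod 2) → ZMod 2 :=
  fun x =>
    f fun i =>
      g fun j => x ⟨(i : ℕ) + (j : ℕ), by have := i.isLt; have := j.isLt; omega⟩

/-- `Seq(h)`: the set of sequences generated by the FSR with characteristic
function `h : 𝔽₂^(q+1) → 𝔽₂`. -/
def SeqSet (q : ℕ) (h : (Fin (q + 1) → ZMod 2) → ZMod 2) : Set (ℤ → ZMod 2) :=
  {s | ∀ t : ℤ, h (fun i : Fin (q + 1) => s (t + (i : ℕ))) = 0}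

/-- If `h : 𝔽₂^(m+1) → 𝔽₂` (here `m = n + k` with `1 ≤ k < m`) satisfies
`h(0,…,0) = 0` and decomposes as `h = f ⋆ g`, then there is a decomposition
`h = h1 ⋆ h2` with `h2(0,…,0) = 0`, `h1(0,…,0) = 0` and `Seq(h2) ⊆ Seq(h)`. -/
theorem stmt_18 (n k : ℕ) (hn : 1 ≤ n) (hk : 1 ≤ k)
    (h : (Fin (n + k + 1) → ZMod 2) → ZMod 2)
    (f : (Fin (n + 1) → ZMod 2) → ZMod 2) (g : (Fin (k + 1) → ZMod 2) → ZMod 2)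
    (h0 : h (fun _ => 0) = 0) (hfg : h = starF n k f g) :
    ∃ (h1 : (Fin (n + 1) → ZMod 2) → ZMod 2)
      (h2 : (Fin (k + 1) → ZMod 2) → ZMod 2),
      h = starF n k h1 h2 ∧ h2 (fun _ => 0) = 0 ∧ h1 (fun _ => 0) = 0 ∧
        SeqSet k h2 ⊆ SeqSet (n + k) h := by
  subst hfg
  refine ⟨fun y => f fun i => y i + g fun _ => 0, fun x => g x - g fun _ => 0, ?_, sub_self _, ?_, ?_⟩
  · funext x
    simp [starF]
  · simpa [starF] using h0
  · intro s hs t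
    have hg : ∀ i : Fin (n + 1),
        (g fun j : Fin (k + 1) => s (t + ((i + j : ℕ) : ℤ))) = g fun _ => 0 := fun i => by
      simpa [sub_eq_zero, add_assoc] using hs (t + (i : ℕ))
    simpa only [starF, hg] using h0
end

section
/- Let k ≥ 0 be an integer and ℓ = 3^k. Let L : 𝔽₂^{2ℓ} → 𝔽₂^{2ℓ} be the linear map L(w_0, …, w_{2ℓ−1}) = (w_1, …, w_{2ℓ−1}, w_ℓ + w_0), and let w⁰ = (0, …, 0, 1) ∈ 𝔽₂^{2ℓ}. Suppose V ⊆ 𝔽₂^{2ℓ} is nonempty and closed under both maps v ↦ L(v) and v ↦ L(v) + w⁰. Then (0, …, 0) ∈ V. -/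
/-- For `ℓ = 3^k`, let `L` be the state transformation of the `2ℓ`-stage LFSR with
characteristic polynomial `X^(2ℓ)+X^ℓ+1`, i.e.
`L(w_0,…,w_{2ℓ−1}) = (w_1,…,w_{2ℓ−1}, w_ℓ + w_0)`, and let `w⁰ = (0,…,0,1)`.
If `V ⊆ 𝔽₂^(2ℓ)` is nonempty and closed under both `v ↦ L(v)` and
`v ↦ L(v) + w⁰`, then `(0,…,0) ∈ V`. -/
theorem stmt_19 (k : ℕ)
    (L : (Fin (2 * 3 ^ k) → ZMod 2) → (Fin (2 * 3 ^ k) → ZMod 2))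
    (hL : ∀ (w : Fin (2 * 3 ^ k) → ZMod 2) (i : Fin (2 * 3 ^ k)),
      L w i =
        if h : (i : ℕ) + 1 < 2 * 3 ^ k then w ⟨(i : ℕ) + 1, h⟩
        else
          w ⟨3 ^ k, by have := pow_pos (by norm_num : (0:ℕ) < 3) k; omega⟩ +
            w ⟨0, by have := pow_pos (by norm_num : (0:ℕ) < 3) k; omega⟩)
    (w0 : Fin (2 * 3 ^ k) → ZMod 2)
    (hw0 : w0 = fun i : Fin (2 * 3 ^ k) =>
      if (i : ℕ) = 2 * 3 ^ k - 1 then (1 : ZMod 2) else 0)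
    (V : Set (Fin (2 * 3 ^ k) → ZMod 2)) (hne : V.Nonempty)
    (hcl1 : ∀ v ∈ V, L v ∈ V) (hcl2 : ∀ v ∈ V, L v + w0 ∈ V) :
    (fun _ => (0 : ZMod 2)) ∈ V := by
  -- Feed in the bit that makes the last coordinate vanish: the block of trailing zeros grows.
  have trailing_zeros : ∀ j : ℕ, ∃ v ∈ V,
      ∀ i : Fin (2 * 3 ^ k), 2 * 3 ^ k ≤ (i : ℕ) + j → v i = 0 := by
    intro j
    induction j with
    | zero =>
      obtain ⟨v, hv⟩ := hne
      exact ⟨v, hv, fun i hi => absurd i.isLt (by omega)⟩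
    | succ j ih =>
      obtain ⟨v, hv, hz⟩ := ih
      have shift : ∀ i : Fin (2 * 3 ^ k), 2 * 3 ^ k ≤ (i : ℕ) + (j + 1) →
          (i : ℕ) + 1 < 2 * 3 ^ k → L v i = 0 := by
        intro i hi h
        rw [hL, dif_pos h]
        exact hz _ (by simp only; omega)
      have hpos : 0 < 3 ^ k := pow_pos (by norm_num) k
      let last : Fin (2 * 3 ^ k) := ⟨2 * 3 ^ k - 1, by omega⟩
      have eq_last : ∀ i : Fin (2 * 3 ^ k), ¬ (i : ℕ) + 1 < 2 * 3 ^ k → i = last :=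
        fun i h => Fin.ext (by have := i.isLt; simp only [last]; omega)
      by_cases h0 : L v last = 0
      · refine ⟨L v, hcl1 v hv, fun i hi => ?_⟩
        by_cases h : (i : ℕ) + 1 < 2 * 3 ^ k
        · exact shift i hi h
        · rw [eq_last i h, h0]
      · have h1 : L v last = 1 := (by decide : ∀ x : ZMod 2, x ≠ 0 → x = 1) _ h0
        refine ⟨L v + w0, hcl2 v hv, fun i hi => ?_⟩
        by_cases h : (i : ℕ) + 1 < 2 * 3 ^ k
        · have hne_last : (i : ℕ) ≠ 2 * 3 ^ k - 1 := by omega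
          simp [shift i hi h, hw0, hne_last]
        · rw [eq_last i h, Pi.add_apply, h1, hw0]
          simp only [last, if_true]
          decide
  obtain ⟨v, hv, hz⟩ := trailing_zeros (2 * 3 ^ k)
  have : v = fun _ => 0 := funext fun i => hz i (by omega)
  exact this ▸ hv
end
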